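/- Let k ≥ 2 be an integer, t ∈ [0,1), and z ∈ ℂ with |z| = 1, and suppose (z,t) lies below the φ_e curve. Then B_{z,t,k} is expanding on the unit circle: there exist c > 0 and λ > 1 such that for every w with |w| = 1 and every integer n ≥ 1, the complex derivative of the n-fold composition satisfies |(B_{z,t,k}^n)'(w)| ≥ c·λ^n. -/

import Mathlib

/-- The Blaschke product `B_{z,t,k}(w) = z·((w + t)/(1 + w·t))^k`. -/
noncomputable def Blaschke (z : ℂ) (t : ℝ) (k : ℕ) (w : ℂ) : ℂ :=
  z * ((w + (t : ℂ)) / (1 + w * (t : ℂ))) ^ k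

/-- The root with nonnegative imaginary part of the quadratic
`t·w² + ((k+1)·t² − (k−1))·w + t = 0` (for `t_c ≤ t < 1` the discriminant
`(k+1)²t⁴ − 2(k²+1)t² + (k−1)²` is `≤ 0`, so the root is
`(−b + i·√(−disc))/(2t)` with `b = (k+1)t² − (k−1)`). -/
noncomputable def wbullet (k : ℕ) (t : ℝ) : ℂ :=
  (-((((k : ℂ)) + 1) * (t : ℂ)^2 - ((k : ℂ) - 1)) +
    Complex.I * ((Real.sqrt (-(((k : ℝ) + 1)^2 * t^4 - 2 * ((k : ℝ)^2 + 1) * t^2 +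
      ((k : ℝ) - 1)^2)) : ℝ) : ℂ)) / (2 * (t : ℂ))

/-- The edge angle `φ_e(t) = Arg(w_•(t)·((1 + w_•(t)·t)/(w_•(t) + t))^k)`. -/
noncomputable def phie (k : ℕ) (t : ℝ) : ℝ :=
  (wbullet k t * ((1 + wbullet k t * (t : ℂ)) / (wbullet k t + (t : ℂ))) ^ k).arg

/-- `(z,t)` lies below the `φ_e` curve: either `0 ≤ t < t_c`, or
`t_c ≤ t < 1` and `φ_e(t) < |Arg z| ≤ π`. -/
def belowCurve (k : ℕ) (t : ℝ) (z : ℂ) : Prop :=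
  (0 ≤ t ∧ t < ((k : ℝ) - 1) / ((k : ℝ) + 1)) ∨
  (((k : ℝ) - 1) / ((k : ℝ) + 1) ≤ t ∧ t < 1 ∧ phie k t < |z.arg| ∧ |z.arg| ≤ Real.pi)

open Polynomial in
/-- The sum of `N / Q'` over the simple roots of `Q`. -/
theorem sum_eval_div_eval_derivative (Q N : ℂ[X]) (hnd : Q.roots.Nodup)
    (hN : N.degree < Q.natDegree) :
    ∑ x ∈ Q.roots.toFinset, N.eval x / Q.derivative.eval x
      = N.coeff (Q.natDegree - 1) / Q.leadingCoeff := by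
  have hs : (Q.roots.toFinset.card) = Q.natDegree := by
    rw [Multiset.toFinset_card_of_nodup hnd, IsAlgClosed.card_roots_eq_natDegree]
  have hfac : Q = C Q.leadingCoeff * Lagrange.nodal Q.roots.toFinset id := by
    conv_lhs => rw [(IsAlgClosed.splits Q).eq_prod_roots]
    rw [Lagrange.nodal, Finset.prod, Multiset.toFinset_val, hnd.dedup]
    rfl
  have h := Lagrange.coeff_eq_sum (s := Q.roots.toFinset) (v := id)
    (Function.injective_id.injOn) (P := N) (by rw [hs]; exact hN)
  rw [← hs, h, Finset.sum_div]
  refine Finset.sum_congr rfl fun x hx ↦ ?_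
  have hd : Q.derivative.eval x
      = Q.leadingCoeff * ∏ j ∈ Q.roots.toFinset.erase x, (x - j) := by
    conv_lhs => rw [hfac]
    rw [derivative_C_mul, eval_C_mul]
    have := Lagrange.eval_nodal_derivative_eval_node_eq (v := id) hx
    rw [id] at this
    rw [this, Lagrange.eval_nodal]
    rfl
  rw [hd, div_div, mul_comm]
  rfl

theorem normSq_one_add_mul (w : ℂ) (t : ℝ) :
    ‖1 + w * t‖ ^ 2 = 1 + 2 * t * w.re + t ^ 2 * ‖w‖ ^ 2 := by
  rw [← Complex.normSq_eq_norm_sq, ← Complex.normSq_eq_norm_sq, Complex.normSq_apply,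
    Complex.normSq_apply]
  simp
  ring

theorem normSq_add_ofReal (w : ℂ) (t : ℝ) :
    ‖w + t‖ ^ 2 = ‖w‖ ^ 2 + 2 * t * w.re + t ^ 2 := by
  rw [← Complex.normSq_eq_norm_sq, ← Complex.normSq_eq_norm_sq, Complex.normSq_apply,
    Complex.normSq_apply]
  simp
  ring

theorem norm_add_eq_norm_one_add {w : ℂ} (hw : ‖w‖ = 1) (t : ℝ) : ‖w + t‖ = ‖1 + w * t‖ := by
  rw [← sq_eq_sq₀ (norm_nonneg _) (norm_nonneg _), normSq_one_add_mul, normSq_add_ofReal, hw]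
  ring

theorem one_add_mul_ne_zero {t : ℝ} (ht0 : 0 ≤ t) (ht1 : t < 1) {w : ℂ} (hw : ‖w‖ ≤ 1) :
    1 + w * (t : ℂ) ≠ 0 := by
  intro h
  have h1 : ‖w * (t : ℂ)‖ = 1 := by
    rw [eq_neg_of_add_eq_zero_right h]; simp
  rw [norm_mul, Complex.norm_real, Real.norm_of_nonneg ht0] at h1
  nlinarith [norm_nonneg w]

theorem add_ne_zero_of_norm_eq_one {t : ℝ} (ht0 : 0 ≤ t) (ht1 : t < 1) {w : ℂ} (hw : ‖w‖ = 1) :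
    w + (t : ℂ) ≠ 0 := by
  rw [← norm_ne_zero_iff, norm_add_eq_norm_one_add hw, norm_ne_zero_iff]
  exact one_add_mul_ne_zero ht0 ht1 hw.le

theorem norm_blaschke {z : ℂ} (hz : ‖z‖ = 1) {t : ℝ} (ht0 : 0 ≤ t) (ht1 : t < 1) (k : ℕ) {w : ℂ}
    (hw : ‖w‖ = 1) : ‖Blaschke z t k w‖ = 1 := by
  have := norm_ne_zero_iff.2 (one_add_mul_ne_zero ht0 ht1 hw.le)
  rw [Blaschke, norm_mul, norm_pow, norm_div, hz, norm_add_eq_norm_one_add hw, div_self this]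
  simp

theorem hasDerivAt_blaschke (z : ℂ) (t : ℝ) (k : ℕ) {w : ℂ} (hw : 1 + w * (t : ℂ) ≠ 0) :
    HasDerivAt (Blaschke z t k)
      (z * (k * ((w + t) / (1 + w * t)) ^ (k - 1) * ((1 - t ^ 2) / (1 + w * t) ^ 2))) w := by
  have h1 : HasDerivAt (fun w : ℂ ↦ (w + t) / (1 + w * t)) ((1 - t ^ 2) / (1 + w * t) ^ 2) w := by
    have := ((hasDerivAt_id w).add_const (t : ℂ)).div
      (((hasDerivAt_id w).mul_const (t : ℂ)).const_add 1) hw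
    convert! this using 1
    simp only [id]
    ring
  exact (h1.pow k).const_mul z

theorem norm_deriv_blaschke {z : ℂ} (hz : ‖z‖ = 1) {t : ℝ} (ht0 : 0 ≤ t) (ht1 : t < 1) (k : ℕ)
    {w : ℂ} (hw : ‖w‖ = 1) :
    ‖deriv (Blaschke z t k) w‖ = k * (1 - t ^ 2) / ‖1 + w * t‖ ^ 2 := by
  have h0 := one_add_mul_ne_zero ht0 ht1 hw.le
  have h1 : ‖(1 : ℂ) - t ^ 2‖ = 1 - t ^ 2 := by
    rw [show (1 : ℂ) - t ^ 2 = ((1 - t ^ 2 : ℝ) : ℂ) by push_cast; rfl, Complex.norm_real,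
      Real.norm_of_nonneg (by nlinarith)]
  rw [(hasDerivAt_blaschke z t k h0).deriv, norm_mul, norm_mul, norm_mul, norm_pow, norm_div,
    norm_div, norm_pow, hz, norm_add_eq_norm_one_add hw, div_self (norm_ne_zero_iff.2 h0), h1]
  simp
  ring

theorem sq_geom_sum_lt {k : ℕ} (hk : 2 ≤ k) {r : ℝ} (hr : r < 1) :
    (∑ i ∈ Finset.range k, r ^ i) ^ 2 < k * ∑ i ∈ Finset.range k, (r ^ 2) ^ i := by
  have hk0 : (0 : ℝ) < k := by positivity
  set m := (∑ i ∈ Finset.range k, r ^ i) / k with hm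
  have hS : ∑ i ∈ Finset.range k, r ^ i = m * k := by rw [hm]; field_simp
  have hpos : 0 < ∑ i ∈ Finset.range k, (r ^ i - m) ^ 2 := by
    by_contra! h
    have h' := (Finset.sum_eq_zero_iff_of_nonneg (fun i _ ↦ sq_nonneg (r ^ i - m))).1
      (le_antisymm h (Finset.sum_nonneg fun i _ ↦ sq_nonneg _))
    have h0 := h' 0 (by simp; omega)
    have h1 := h' 1 (by simp; omega)
    simp [sub_eq_zero] at h0 h1
    linarith
  have hexp : ∑ i ∈ Finset.range k, (r ^ i - m) ^ 2
      = ∑ i ∈ Finset.range k, (r ^ 2) ^ i - 2 * m * ∑ i ∈ Finset.range k, r ^ i + k * m ^ 2 := by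
    rw [Finset.mul_sum, ← Finset.sum_sub_distrib]
    rw [show (k : ℝ) * m ^ 2 = ∑ i ∈ Finset.range k, m ^ 2 by simp, ← Finset.sum_add_distrib]
    refine Finset.sum_congr rfl fun i _ ↦ ?_
    ring
  rw [hexp, hS] at hpos
  rw [hS]
  nlinarith

theorem norm_pow_sub_pow_le (u q : ℂ) (hu : ‖u‖ = 1) (k : ℕ) :
    ‖u ^ k - q ^ k‖ ≤ (∑ i ∈ Finset.range k, ‖q‖ ^ i) * ‖u - q‖ := by
  rw [← neg_sub, norm_neg, ← (Commute.all q u).geom_sum₂_mul, norm_mul, norm_sub_rev]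
  gcongr
  refine (norm_sum_le _ _).trans_eq ?_
  simp [hu]

/-- A Blaschke product with an interior fixed point `p` expands the Poisson metric of `p`. -/
theorem exists_expansion_of_fixed {k : ℕ} (hk : 2 ≤ k) {t : ℝ} (ht0 : 0 ≤ t) (ht1 : t < 1)
    {z : ℂ} (hz : ‖z‖ = 1) {p : ℂ} (hp : ‖p‖ < 1) (hfix : Blaschke z t k p = p) :
    ∃ lam : ℝ, 1 < lam ∧ ∀ w : ℂ, ‖w‖ = 1 →
      lam * ‖Blaschke z t k w - p‖ ^ 2 ≤ ‖deriv (Blaschke z t k) w‖ * ‖w - p‖ ^ 2 := by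
  set q : ℂ := (p + t) / (1 + p * t) with hq
  have hp0 := one_add_mul_ne_zero ht0 ht1 hp.le
  have hpn : 0 < ‖1 + p * t‖ := norm_pos_iff.2 hp0
  have ht2 : 0 < 1 - t ^ 2 := by nlinarith
  have hp2 : 0 < 1 - ‖p‖ ^ 2 := by nlinarith [norm_nonneg p]
  have hq2 : 1 - ‖q‖ ^ 2 = (1 - t ^ 2) * (1 - ‖p‖ ^ 2) / ‖1 + p * t‖ ^ 2 := by
    rw [hq, norm_div, div_pow, normSq_add_ofReal, eq_div_iff (by positivity), sub_mul,
      div_mul_cancel₀ _ (by positivity), normSq_one_add_mul]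
    ring
  have hq1 : ‖q‖ < 1 := by
    have : 0 < 1 - ‖q‖ ^ 2 := by rw [hq2]; positivity
    nlinarith [norm_nonneg q]
  set S1 := ∑ i ∈ Finset.range k, ‖q‖ ^ i with hS1
  set S2 := ∑ i ∈ Finset.range k, (‖q‖ ^ 2) ^ i with hS2
  have hS : S1 ^ 2 < k * S2 := sq_geom_sum_lt hk hq1
  have hS1pos : 1 ≤ S1 := by
    have : ‖q‖ ^ 0 ≤ S1 := Finset.single_le_sum (f := fun i ↦ ‖q‖ ^ i)
      (fun i _ ↦ by positivity) (by simp; omega)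
    simpa using this
  have hk0 : (0 : ℝ) < k := by positivity
  have hS2pos : 0 < S2 := by
    by_contra! h
    nlinarith
  have hpk : ‖p‖ = ‖q‖ ^ k := by
    conv_lhs => rw [← hfix, Blaschke, norm_mul, hz, one_mul, norm_pow]
  have hS2mul : ‖1 + p * t‖ ^ 2 = (1 - t ^ 2) * S2 := by
    have h1 := mul_neg_geom_sum (‖q‖ ^ 2) k
    rw [← pow_mul, mul_comm 2 k, pow_mul, ← hpk, ← hS2, hq2] at h1
    field_simp at h1
    linarith
  refine ⟨k * S2 / S1 ^ 2, (one_lt_div (by positivity)).2 hS, fun w hw ↦ ?_⟩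
  have hw0 := one_add_mul_ne_zero ht0 ht1 hw.le
  have hwn : 0 < ‖1 + w * t‖ := norm_pos_iff.2 hw0
  set u : ℂ := (w + t) / (1 + w * t) with hu
  have hu1 : ‖u‖ = 1 := by
    rw [hu, norm_div, norm_add_eq_norm_one_add hw, div_self hwn.ne']
  have huq : u - q = (w - p) * ((1 - t ^ 2 : ℝ) : ℂ) / ((1 + w * t) * (1 + p * t)) := by
    rw [hu, hq, div_sub_div _ _ hw0 hp0]
    push_cast
    ring
  have huqn : ‖u - q‖ ^ 2 =
      ‖w - p‖ ^ 2 * (1 - t ^ 2) ^ 2 / (‖1 + w * t‖ ^ 2 * ‖1 + p * t‖ ^ 2) := by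
    rw [huq, norm_div, norm_mul, norm_mul, Complex.norm_real, Real.norm_of_nonneg ht2.le]
    ring
  have hB : ‖Blaschke z t k w - p‖ ^ 2 ≤ S1 ^ 2 * ‖u - q‖ ^ 2 := by
    have : Blaschke z t k w - p = z * (u ^ k - q ^ k) := by
      conv_lhs => rw [← hfix]
      rw [Blaschke, Blaschke]; ring
    rw [this, norm_mul, hz, one_mul, ← mul_pow]
    gcongr
    exact norm_pow_sub_pow_le u q hu1 k
  rw [norm_deriv_blaschke hz ht0 ht1 k hw]
  calc k * S2 / S1 ^ 2 * ‖Blaschke z t k w - p‖ ^ 2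
      ≤ k * S2 / S1 ^ 2 * (S1 ^ 2 * ‖u - q‖ ^ 2) := by gcongr
    _ = k * (1 - t ^ 2) / ‖1 + w * t‖ ^ 2 * ‖w - p‖ ^ 2 := by
      rw [huqn, hS2mul]
      field_simp

theorem norm_deriv_iterate_ge {k : ℕ} {t : ℝ} (ht0 : 0 ≤ t) (ht1 : t < 1)
    {z : ℂ} (hz : ‖z‖ = 1) {p : ℂ} {lam : ℝ} (hlam : 0 ≤ lam)
    (h : ∀ w : ℂ, ‖w‖ = 1 →
      lam * ‖Blaschke z t k w - p‖ ^ 2 ≤ ‖deriv (Blaschke z t k) w‖ * ‖w - p‖ ^ 2)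
    (n : ℕ) {w : ℂ} (hw : ‖w‖ = 1) :
    DifferentiableAt ℂ (Blaschke z t k)^[n] w ∧
    lam ^ n * ‖(Blaschke z t k)^[n] w - p‖ ^ 2
      ≤ ‖deriv (Blaschke z t k)^[n] w‖ * ‖w - p‖ ^ 2 := by
  induction n generalizing w with
  | zero => simp
  | succ n ih =>
    obtain ⟨hd, hle⟩ := ih (norm_blaschke hz ht0 ht1 k hw)
    have hB := (hasDerivAt_blaschke z t k (one_add_mul_ne_zero ht0 ht1 hw.le)).differentiableAt
    rw [Function.iterate_succ]
    refine ⟨hd.comp w hB, ?_⟩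
    rw [deriv_comp w hd hB, norm_mul, Function.comp_apply, pow_succ]
    calc _ = lam * (lam ^ n * ‖(Blaschke z t k)^[n] (Blaschke z t k w) - p‖ ^ 2) := by ring
      _ ≤ lam * (‖deriv (Blaschke z t k)^[n] (Blaschke z t k w)‖ * ‖Blaschke z t k w - p‖ ^ 2) := by
        gcongr
      _ = ‖deriv (Blaschke z t k)^[n] (Blaschke z t k w)‖ * (lam * ‖Blaschke z t k w - p‖ ^ 2) := by
        ring
      _ ≤ _ := by
        rw [mul_assoc]
        exact mul_le_mul_of_nonneg_left (h w hw) (norm_nonneg _)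

open Polynomial in
/-- If every fixed point on the unit circle is repelling, there is a fixed point in the disk. -/
theorem exists_interior_fixed_point {k : ℕ} (hk : 2 ≤ k) {t : ℝ} (ht0 : 0 ≤ t) (ht1 : t < 1)
    {z : ℂ} (hz : ‖z‖ = 1)
    (h : ∀ p : ℂ, ‖p‖ = 1 → Blaschke z t k p = p → ‖1 + p * t‖ ^ 2 < k * (1 - t ^ 2)) :
    ∃ p : ℂ, ‖p‖ < 1 ∧ Blaschke z t k p = p := by
  rcases ht0.eq_or_lt with rfl | htpos
  · exact ⟨0, by simp, by simp [Blaschke]; omega⟩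
  by_contra! hno
  have htc : (t : ℂ) ≠ 0 := by exact_mod_cast htpos.ne'
  set N : ℂ[X] := (C (t : ℂ) * X + C 1) ^ k with hN
  set M : ℂ[X] := C z * (X + C (t : ℂ)) ^ k with hM
  set Q : ℂ[X] := X * N - M with hQ
  have hNdeg : N.natDegree = k := by
    rw [hN, natDegree_pow, natDegree_linear htc, mul_one]
  have hNlead : N.leadingCoeff = (t : ℂ) ^ k := by
    rw [hN, leadingCoeff_pow, leadingCoeff_linear htc]
  have hN0 : N ≠ 0 := by
    rw [← leadingCoeff_ne_zero, hNlead]; exact pow_ne_zero _ htc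
  have hz0 : z ≠ 0 := by rw [← norm_ne_zero_iff, hz]; simp
  have hXN : (X * N).natDegree = k + 1 := by
    rw [natDegree_X_mul hN0, hNdeg]
  have hMdeg : M.natDegree ≤ k := by
    rw [hM, natDegree_C_mul hz0, natDegree_pow, natDegree_X_add_C, mul_one]
  have hQdeg : Q.natDegree = k + 1 := by
    rw [hQ, natDegree_sub_eq_left_of_natDegree_lt (by omega), hXN]
  have hQlead : Q.leadingCoeff = (t : ℂ) ^ k := by
    rw [leadingCoeff, hQdeg, hQ, coeff_sub, coeff_X_mul,
      coeff_eq_zero_of_natDegree_lt (by omega : M.natDegree < k + 1), sub_zero, ← hNlead,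
      leadingCoeff, hNdeg]
  have hQ0 : Q ≠ 0 := by
    rw [← leadingCoeff_ne_zero, hQlead]; exact pow_ne_zero _ htc
  have hroot : ∀ p, Q.IsRoot p ↔ p * (1 + p * t) ^ k = z * (p + t) ^ k := by
    intro p
    rw [IsRoot.def, hQ, hN, hM]
    simp only [eval_sub, eval_mul, eval_pow, eval_add, eval_C, eval_X]
    rw [sub_eq_zero, mul_comm (t : ℂ) p, add_comm (p * (t : ℂ)) 1]
  have hfix : ∀ p, ‖p‖ ≤ 1 → Q.IsRoot p → Blaschke z t k p = p := by
    intro p hp hr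
    have := one_add_mul_ne_zero ht0 ht1 hp
    rw [Blaschke, div_pow, ← mul_div_assoc, ← (hroot p).1 hr]
    field_simp
  have hin : ∀ p, Q.IsRoot p → 1 ≤ ‖p‖ := by
    intro p hr
    by_contra! hlt
    exact hno p hlt (hfix p hlt.le hr)
  have hout : ∀ p, Q.IsRoot p → ‖p‖ = 1 := by
    intro p hr
    have hp1 := hin p hr
    have hp0 : p ≠ 0 := by rw [← norm_pos_iff]; linarith
    refine le_antisymm ?_ hp1
    set c := (starRingEnd ℂ) p with hc
    have hc0 : c ≠ 0 := by simpa [hc] using hp0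
    have hzz : z * (starRingEnd ℂ) z = 1 := by
      rw [Complex.mul_conj, Complex.normSq_eq_norm_sq, hz]; simp
    have hr' := congrArg (starRingEnd ℂ) ((hroot p).1 hr)
    simp only [map_mul, map_pow, map_add, map_one, Complex.conj_ofReal, ← hc] at hr'
    have hinv : Q.IsRoot c⁻¹ := by
      rw [hroot]
      have e1 : 1 + c⁻¹ * (t : ℂ) = c⁻¹ * (c + t) := by field_simp
      have e2 : c⁻¹ + (t : ℂ) = c⁻¹ * (1 + c * t) := by field_simp
      rw [e1, e2, mul_pow, mul_pow]
      have : (c + (t : ℂ)) ^ k = z * (c * (1 + c * t) ^ k) := by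
        rw [hr', ← mul_assoc, hzz, one_mul]
      rw [this]
      field_simp
    have := hin _ hinv
    rw [norm_inv, hc, RCLike.norm_conj] at this
    exact (one_le_inv₀ (by linarith)).1 this
  have hder : ∀ p, Q.IsRoot p → ∃ d : ℝ, 1 < d ∧ N.eval p ≠ 0 ∧
      Q.derivative.eval p = N.eval p * ((1 - d : ℝ) : ℂ) := by
    intro p hr
    have hp1 := hout p hr
    have hlt := h p hp1 (hfix p hp1.le hr)
    have hne := one_add_mul_ne_zero ht0 ht1 hp1.le
    have hne' := add_ne_zero_of_norm_eq_one ht0 ht1 hp1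
    have hpos : 0 < ‖1 + p * t‖ := norm_pos_iff.2 hne
    have hp0 : p ≠ 0 := by rw [← norm_pos_iff]; linarith
    have hNe : N.eval p = (1 + p * t) ^ k := by
      rw [hN]
      simp only [eval_mul, eval_pow, eval_add, eval_C, eval_X]
      rw [mul_comm (t : ℂ) p, add_comm (p * (t : ℂ)) 1]
    refine ⟨k * (1 - t ^ 2) / ‖1 + p * t‖ ^ 2, (one_lt_div (by positivity)).2 hlt, ?_, ?_⟩
    · rw [hNe]; exact pow_ne_zero _ hne
    · have hmul : ((‖1 + p * t‖ ^ 2 : ℝ) : ℂ) * p = (1 + p * t) * (p + t) := by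
        have hpp : p * (starRingEnd ℂ) p = 1 := by
          rw [Complex.mul_conj, Complex.normSq_eq_norm_sq, hp1]; simp
        rw [← Complex.normSq_eq_norm_sq, ← Complex.mul_conj]
        simp only [map_mul, map_add, map_one, Complex.conj_ofReal]
        linear_combination (1 + p * t) * t * hpp
      have hnsq : ((‖1 + p * t‖ ^ 2 : ℝ) : ℂ) = (1 + p * t) * (p + t) / p := by
        rw [← hmul]; field_simp
      obtain ⟨j, rfl⟩ : ∃ j, k = j + 1 := ⟨k - 1, by omega⟩
      have hr' := (hroot p).1 hr
      have hM' : z * (p + t) ^ j = p * (1 + p * t) ^ (j + 1) / (p + t) := by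
        rw [hr', pow_succ, ← mul_assoc, mul_div_cancel_right₀ _ hne']
      have hQ' : Q.derivative.eval p = (1 + p * t) ^ (j + 1)
          + p * ((j + 1) * (1 + p * t) ^ j * t) - (j + 1) * (z * (p + t) ^ j) := by
        simp [hQ, hN, hM, derivative_pow]
        ring
      rw [hQ', hM', hNe, Complex.ofReal_sub, Complex.ofReal_div, hnsq]
      push_cast
      field_simp
      ring
  have hnd : Q.roots.Nodup := by
    rw [Multiset.nodup_iff_count_le_one]
    intro p
    rw [count_roots]
    by_contra! hlt
    obtain ⟨hr', hr⟩ := (one_lt_rootMultiplicity_iff_isRoot hQ0).1 hlt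
    obtain ⟨d, hd, hNe, hQe⟩ := hder p (by tauto)
    rcases mul_eq_zero.1 (hQe.symm.trans (by tauto)) with h0 | h0
    · exact hNe h0
    · rw [Complex.ofReal_eq_zero] at h0
      linarith
  have hsum := sum_eval_div_eval_derivative Q N hnd
    (by rw [hQdeg, degree_eq_natDegree hN0, hNdeg]; exact_mod_cast Nat.lt_succ_self k)
  rw [hQdeg, Nat.add_sub_cancel, hQlead, ← hNlead, leadingCoeff, hNdeg, div_self] at hsum
  · have hre := congrArg Complex.re hsum
    rw [Complex.re_sum, Complex.one_re] at hre
    have : ∑ x ∈ Q.roots.toFinset, (N.eval x / Q.derivative.eval x).re ≤ 0 := by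
      refine Finset.sum_nonpos fun x hx ↦ ?_
      rw [Multiset.mem_toFinset, mem_roots hQ0] at hx
      obtain ⟨d, hd, hNe, hQe⟩ := hder x hx
      rw [hQe, div_mul_cancel_left₀ hNe, ← Complex.ofReal_inv, Complex.ofReal_re]
      exact inv_nonpos.2 (by linarith)
    linarith
  · rw [← hNdeg]; exact leadingCoeff_ne_zero.2 hN0

/-- The parameter `z` for which the point `w` of the unit circle is fixed by `Blaschke z t k`. -/
noncomputable def edgeMap (t : ℝ) (k : ℕ) (w : ℂ) : ℂ :=
  w * ((1 + w * (t : ℂ)) / (w + (t : ℂ))) ^ k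

/-- A continuous lift of the argument of `edgeMap t k` along the unit circle. -/
noncomputable def edgeLift (t : ℝ) (k : ℕ) (θ : ℝ) : ℝ :=
  (1 - k) * θ + 2 * k * (Complex.log (1 + Complex.exp (θ * Complex.I) * t)).im

theorem one_add_exp_mul_mem_slitPlane {t : ℝ} (ht0 : 0 ≤ t) (ht1 : t < 1) (θ : ℝ) :
    1 + Complex.exp (θ * Complex.I) * t ∈ Complex.slitPlane := by
  left
  have : (1 + Complex.exp (θ * Complex.I) * t).re = 1 + Real.cos θ * t := by
    simp [Complex.exp_ofReal_mul_I_re]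
  rw [this]
  nlinarith [Real.neg_one_le_cos θ]

theorem exp_edgeLift {t : ℝ} (ht0 : 0 ≤ t) (ht1 : t < 1) (k : ℕ) (θ : ℝ) :
    Complex.exp (edgeLift t k θ * Complex.I) = edgeMap t k (Complex.exp (θ * Complex.I)) := by
  set w := Complex.exp (θ * Complex.I) with hw
  have hw1 : ‖w‖ = 1 := Complex.norm_exp_ofReal_mul_I θ
  have hne := one_add_mul_ne_zero ht0 ht1 hw1.le
  have hne' := add_ne_zero_of_norm_eq_one ht0 ht1 hw1
  have hw0 : w ≠ 0 := Complex.exp_ne_zero _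
  set L := Complex.log (1 + w * t) with hL
  have hwc : w * (starRingEnd ℂ) w = 1 := by
    rw [Complex.mul_conj, Complex.normSq_eq_norm_sq, hw1]; simp
  have h2 : (2 * L.im : ℂ) * Complex.I = L - (starRingEnd ℂ) L := by
    apply Complex.ext <;> simp
    ring
  have hexp : Complex.exp ((2 * L.im : ℂ) * Complex.I) = w * ((1 + w * t) / (w + t)) := by
    rw [h2, Complex.exp_sub, Complex.exp_conj, hL, Complex.exp_log hne]
    simp only [map_mul, map_add, map_one, Complex.conj_ofReal]
    have hc : w + t = w * (1 + (starRingEnd ℂ) w * t) := by linear_combination -(t : ℂ) * hwc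
    rw [hc]
    have : 1 + (starRingEnd ℂ) w * t ≠ 0 := by
      intro h0; rw [h0, mul_zero] at hc; exact hne' hc
    field_simp
  have hsplit : (edgeLift t k θ : ℂ) * Complex.I
      = θ * Complex.I - k * (θ * Complex.I) + k * ((2 * L.im : ℂ) * Complex.I) := by
    rw [edgeLift]
    push_cast
    ring
  rw [hsplit, Complex.exp_add, Complex.exp_sub, Complex.exp_nat_mul, Complex.exp_nat_mul, hexp,
    ← hw, edgeMap, mul_pow]
  field_simp

theorem hasDerivAt_edgeLift {t : ℝ} (ht0 : 0 ≤ t) (ht1 : t < 1) (k : ℕ) (θ : ℝ) :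
    HasDerivAt (edgeLift t k)
      (1 - k * (1 - t ^ 2) / (1 + 2 * t * Real.cos θ + t ^ 2)) θ := by
  have hmem := one_add_exp_mul_mem_slitPlane ht0 ht1 θ
  have h1 : HasDerivAt (fun θ : ℝ ↦ 1 + Complex.exp (θ * Complex.I) * t)
      (Complex.exp (θ * Complex.I) * Complex.I * t) θ := by
    have := ((((Complex.ofRealCLM.hasDerivAt (x := θ)).mul_const Complex.I).cexp).mul_const
      (t : ℂ)).const_add 1
    simpa using this
  have h2 := (h1.clog_real hmem)
  have h3 := (Complex.imCLM.hasFDerivAt.comp_hasDerivAt θ h2)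
  have h4 := ((hasDerivAt_id θ).const_mul (1 - k : ℝ)).add (h3.const_mul (2 * k : ℝ))
  convert! h4 using 1
  have hD : (0 : ℝ) < 1 + 2 * t * Real.cos θ + t ^ 2 := by
    nlinarith [Real.neg_one_le_cos θ]
  have hD2 : Complex.normSq (1 + Complex.exp (θ * Complex.I) * t)
      = 1 + 2 * t * Real.cos θ + t ^ 2 := by
    rw [Complex.normSq_eq_norm_sq, normSq_one_add_mul, Complex.norm_exp_ofReal_mul_I,
      Complex.exp_ofReal_mul_I_re]
    ring
  rw [Complex.imCLM_apply, Complex.div_im, hD2]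
  simp [Complex.exp_ofReal_mul_I_re, Complex.exp_ofReal_mul_I_im]
  have hs := Real.sin_sq_add_cos_sq θ
  generalize hDe : 1 + 2 * t * Real.cos θ + t ^ 2 = D at *
  field_simp
  linear_combination (-k : ℝ) * hDe + (-2 * k * t ^ 2 : ℝ) * hs

theorem edgeLift_zero (t : ℝ) (ht0 : 0 ≤ t) (k : ℕ) : edgeLift t k 0 = 0 := by
  have : 1 + Complex.exp ((0 : ℝ) * Complex.I) * t = ((1 + t : ℝ) : ℂ) := by simp
  rw [edgeLift, this, Complex.log_im, Complex.arg_ofReal_of_nonneg (by linarith : 0 ≤ 1 + t)]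
  simp

theorem edgeMap_inv (t : ℝ) (k : ℕ) {w : ℂ} (hw : w ≠ 0) :
    edgeMap t k w⁻¹ = (edgeMap t k w)⁻¹ := by
  have e1 : 1 + w⁻¹ * (t : ℂ) = w⁻¹ * (w + t) := by field_simp
  have e2 : w⁻¹ + (t : ℂ) = w⁻¹ * (1 + w * t) := by field_simp
  rw [edgeMap, edgeMap, e1, e2, mul_div_mul_left _ _ (inv_ne_zero hw), mul_inv, ← inv_pow, inv_div]

/-- The argument of `edgeMap` is monotone on the arc where the Blaschke product contracts. -/
theorem abs_arg_edgeMap_le {t : ℝ} (ht0 : 0 ≤ t) (ht1 : t < 1) (k : ℕ) {θ η : ℝ}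
    (hθ : 0 ≤ θ) (hθη : θ ≤ η) (hη : η ≤ Real.pi)
    (h : k * (1 - t ^ 2) ≤ 1 + 2 * t * Real.cos η + t ^ 2) :
    |(edgeMap t k (Complex.exp (θ * Complex.I))).arg|
      ≤ (edgeMap t k (Complex.exp (η * Complex.I))).arg := by
  have hder : ∀ x ∈ Set.Icc 0 η, 0 ≤ 1 - k * (1 - t ^ 2) / (1 + 2 * t * Real.cos x + t ^ 2) ∧
      1 - k * (1 - t ^ 2) / (1 + 2 * t * Real.cos x + t ^ 2) ≤ 1 := by
    intro x hx
    have hc : Real.cos η ≤ Real.cos x := Real.cos_le_cos_of_nonneg_of_le_pi hx.1 hη hx.2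
    have hD : (0 : ℝ) < 1 + 2 * t * Real.cos x + t ^ 2 := by
      nlinarith [Real.neg_one_le_cos x]
    have : 0 ≤ 1 - t ^ 2 := by nlinarith
    constructor
    · rw [sub_nonneg, div_le_one hD]
      nlinarith
    · have : 0 ≤ k * (1 - t ^ 2) / (1 + 2 * t * Real.cos x + t ^ 2) := by positivity
      linarith
  have hcont : Continuous (edgeLift t k) :=
    continuous_iff_continuousAt.2 fun x ↦ (hasDerivAt_edgeLift ht0 ht1 k x).continuousAt
  have hmono : MonotoneOn (edgeLift t k) (Set.Icc 0 η) := by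
    refine monotoneOn_of_deriv_nonneg (convex_Icc 0 η) hcont.continuousOn
      (fun x _ ↦ (hasDerivAt_edgeLift ht0 ht1 k x).differentiableAt.differentiableWithinAt)
      fun x hx ↦ ?_
    rw [(hasDerivAt_edgeLift ht0 ht1 k x).deriv]
    exact (hder x (interior_subset hx)).1
  have hmono' : MonotoneOn (fun x ↦ x - edgeLift t k x) (Set.Icc 0 η) := by
    have hd := fun x ↦ (hasDerivAt_id x).sub (hasDerivAt_edgeLift ht0 ht1 k x)
    refine monotoneOn_of_deriv_nonneg (convex_Icc 0 η) (continuous_id.sub hcont).continuousOn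
      (fun x _ ↦ (hd x).differentiableAt.differentiableWithinAt) fun x hx ↦ ?_
    refine le_of_le_of_eq ?_ (hd x).deriv.symm
    linarith [(hder x (interior_subset hx)).2]
  have hη0 : 0 ≤ η := hθ.trans hθη
  have m0 : (0 : ℝ) ∈ Set.Icc 0 η := ⟨le_rfl, hη0⟩
  have mθ : θ ∈ Set.Icc 0 η := ⟨hθ, hθη⟩
  have mη : η ∈ Set.Icc 0 η := ⟨hη0, le_rfl⟩
  have l1 := hmono m0 mθ hθ
  have l2 := hmono mθ mη hθη
  have l3 := hmono' m0 mη hη0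
  simp only [edgeLift_zero t ht0 k] at l1 l3
  have harg : ∀ x, 0 ≤ edgeLift t k x → edgeLift t k x ≤ Real.pi →
      (edgeMap t k (Complex.exp (x * Complex.I))).arg = edgeLift t k x := by
    intro x h0 h1
    rw [← exp_edgeLift ht0 ht1, Complex.exp_mul_I, Complex.arg_cos_add_sin_mul_I]
    exact ⟨by linarith [Real.pi_pos], h1⟩
  rw [harg θ l1 (by linarith), harg η (by linarith) (by linarith), abs_of_nonneg l1]
  exact l2

theorem norm_wbullet_and_re {k : ℕ} (hk : 2 ≤ k) {t : ℝ}
    (htc : ((k : ℝ) - 1) / ((k : ℝ) + 1) ≤ t) (ht1 : t < 1) :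
    ‖wbullet k t‖ = 1 ∧ 0 ≤ (wbullet k t).im ∧
      1 + 2 * t * (wbullet k t).re + t ^ 2 = k * (1 - t ^ 2) := by
  have hk2 : (2 : ℝ) ≤ k := by exact_mod_cast hk
  have htpos : 0 < t := lt_of_lt_of_le (by apply div_pos <;> linarith) htc
  rw [div_le_iff₀ (by linarith)] at htc
  set Δ : ℝ := -(((k : ℝ) + 1) ^ 2 * t ^ 4 - 2 * ((k : ℝ) ^ 2 + 1) * t ^ 2 + ((k : ℝ) - 1) ^ 2)
    with hΔ
  have hΔ0 : 0 ≤ Δ := by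
    have : Δ = (((k : ℝ) + 1) ^ 2 * t ^ 2 - ((k : ℝ) - 1) ^ 2) * (1 - t ^ 2) := by rw [hΔ]; ring
    rw [this]
    apply mul_nonneg <;> nlinarith
  set b : ℝ := ((k : ℝ) + 1) * t ^ 2 - (k - 1) with hb
  have hw : wbullet k t =
      ((-b / (2 * t) : ℝ) : ℂ) + ((Real.sqrt Δ / (2 * t) : ℝ) : ℂ) * Complex.I := by
    rw [wbullet, ← hΔ, hb]
    push_cast
    ring
  have hre : (wbullet k t).re = -b / (2 * t) := by
    rw [hw, Complex.add_re, Complex.ofReal_re, Complex.re_ofReal_mul, Complex.I_re, mul_zero, add_zero]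
  have him : (wbullet k t).im = Real.sqrt Δ / (2 * t) := by
    rw [hw, Complex.add_im, Complex.ofReal_im, Complex.im_ofReal_mul, Complex.I_im, mul_one, zero_add]
  refine ⟨?_, by rw [him]; positivity, ?_⟩
  · rw [← sq_eq_sq₀ (norm_nonneg _) zero_le_one, ← Complex.normSq_eq_norm_sq,
      Complex.normSq_apply, hre, him]
    have hsq := Real.mul_self_sqrt hΔ0
    field_simp
    rw [sq (Real.sqrt Δ), hsq, hΔ, hb]
    ring
  · rw [hre, hb]
    field_simp
    ring

theorem abs_arg_le_phie {k : ℕ} (hk : 2 ≤ k) {t : ℝ}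
    (htc : ((k : ℝ) - 1) / ((k : ℝ) + 1) ≤ t) (ht0 : 0 < t) (ht1 : t < 1) {z p : ℂ}
    (hp : ‖p‖ = 1) (hfix : Blaschke z t k p = p) (hle : k * (1 - t ^ 2) ≤ ‖1 + p * t‖ ^ 2) :
    |z.arg| ≤ phie k t := by
  have hp0 : p ≠ 0 := by rw [← norm_pos_iff]; linarith
  have hz : z = edgeMap t k p := by
    have h1 := one_add_mul_ne_zero ht0.le ht1 hp.le
    have h2 := add_ne_zero_of_norm_eq_one ht0.le ht1 hp
    have : p * ((1 + p * t) / (p + t)) ^ k = Blaschke z t k p * ((1 + p * t) / (p + t)) ^ k := by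
      rw [hfix]
    have hinv : (p + t) / (1 + p * t) * ((1 + p * t) / (p + t)) = 1 := by
      rw [div_mul_div_comm, mul_comm, div_self (mul_ne_zero h1 h2)]
    rw [edgeMap, this, Blaschke, mul_assoc, ← mul_pow, hinv, one_pow, mul_one]
  obtain ⟨hw1, hwim, hwre⟩ := norm_wbullet_and_re hk htc ht1
  set w := wbullet k t with hw
  have hexp : ∀ v : ℂ, ‖v‖ = 1 → Complex.exp (v.arg * Complex.I) = v := by
    intro v hv
    have := Complex.norm_mul_exp_arg_mul_I v
    rwa [hv, Complex.ofReal_one, one_mul] at this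
  have hcos : ∀ v : ℂ, ‖v‖ = 1 → Real.cos v.arg = v.re := by
    intro v hv
    have := Complex.norm_mul_cos_arg v
    rwa [hv, one_mul] at this
  have key : ∀ v : ℂ, ‖v‖ = 1 → 0 ≤ v.arg → k * (1 - t ^ 2) ≤ ‖1 + v * t‖ ^ 2 →
      |(edgeMap t k v).arg| ≤ phie k t := by
    intro v hv h0 hle
    have hvw : v.arg ≤ w.arg := by
      by_contra! hlt
      have := Real.cos_lt_cos_of_nonneg_of_le_pi (Complex.arg_nonneg_iff.2 hwim)
        (Complex.arg_le_pi v) hlt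
      rw [hcos v hv, hcos w hw1] at this
      rw [normSq_one_add_mul, hv] at hle
      nlinarith
    have := abs_arg_edgeMap_le ht0.le ht1 k h0 hvw (Complex.arg_le_pi w)
      (by rw [hcos w hw1, hwre])
    rwa [hexp v hv, hexp w hw1] at this
  rw [hz]
  rcases le_or_gt 0 p.arg with h0 | h0
  · exact key p hp h0 hle
  · have hinv : ‖p⁻¹‖ = 1 := by rw [norm_inv, hp, inv_one]
    have := key p⁻¹ hinv ?_ ?_
    · rwa [edgeMap_inv t k hp0, Complex.abs_arg_inv] at this
    · rw [Complex.arg_inv, if_neg (by linarith [Real.pi_pos])]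
      linarith
    · have hre : p⁻¹.re = p.re := by
        rw [Complex.inv_re, Complex.normSq_eq_norm_sq, hp]; simp
      rw [normSq_one_add_mul, hinv, hre]
      rwa [normSq_one_add_mul, hp] at hle

theorem stmt3 (k : ℕ) (hk : 2 ≤ k) (t : ℝ) (ht0 : 0 ≤ t) (ht1 : t < 1)
    (z : ℂ) (hz : ‖z‖ = 1) (hbc : belowCurve k t z) :
    ∃ c : ℝ, 0 < c ∧ ∃ lam : ℝ, 1 < lam ∧
      ∀ w : ℂ, ‖w‖ = 1 → ∀ n : ℕ, 1 ≤ n →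
        c * lam ^ n ≤ ‖deriv ((Blaschke z t k)^[n]) w‖ := by
  have hk2 : (2 : ℝ) ≤ k := by exact_mod_cast hk
  have hrep : ∀ p : ℂ, ‖p‖ = 1 → Blaschke z t k p = p → ‖1 + p * t‖ ^ 2 < k * (1 - t ^ 2) := by
    intro p hp hfix
    rcases hbc with ⟨-, hlt⟩ | ⟨htc, -, harg, -⟩
    · rw [lt_div_iff₀ (by linarith)] at hlt
      have hre : p.re ≤ 1 := (Complex.re_le_norm p).trans hp.le
      rw [normSq_one_add_mul, hp]
      nlinarith [mul_le_mul_of_nonneg_left hre ht0]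
    · by_contra! hle
      have htpos : 0 < t := lt_of_lt_of_le (by apply div_pos <;> linarith) htc
      exact absurd (abs_arg_le_phie hk htc htpos ht1 hp hfix hle) (not_le.2 harg)
  obtain ⟨p, hp, hfix⟩ := exists_interior_fixed_point hk ht0 ht1 hz hrep
  obtain ⟨lam, hlam, hexp⟩ := exists_expansion_of_fixed hk ht0 ht1 hz hp hfix
  have hdist : ∀ w : ℂ, ‖w‖ = 1 → 1 - ‖p‖ ≤ ‖w - p‖ ∧ ‖w - p‖ ≤ 2 := by
    intro w hw
    have h1 := norm_sub_norm_le w p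
    have h2 := norm_sub_le w p
    rw [hw] at h1 h2
    exact ⟨h1, by linarith⟩
  have hp' : 0 < 1 - ‖p‖ := by linarith
  refine ⟨(1 - ‖p‖) ^ 2 / 4, by positivity, lam, hlam, fun w hw n hn ↦ ?_⟩
  have hiter : ‖(Blaschke z t k)^[n] w‖ = 1 := by
    clear hn
    induction n with
    | zero => simpa using hw
    | succ n ih =>
      rw [Function.iterate_succ_apply']
      exact norm_blaschke hz ht0 ht1 k ih
  have hmain := (norm_deriv_iterate_ge ht0 ht1 hz (by linarith) hexp n hw).2
  have hlow : lam ^ n * (1 - ‖p‖) ^ 2 ≤ lam ^ n * ‖(Blaschke z t k)^[n] w - p‖ ^ 2 := by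
    gcongr
    exact (hdist _ hiter).1
  have hup : ‖deriv (Blaschke z t k)^[n] w‖ * ‖w - p‖ ^ 2
      ≤ ‖deriv (Blaschke z t k)^[n] w‖ * 2 ^ 2 := by
    gcongr
    exact (hdist w hw).2
  linarith
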